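/- Let G be a connected bipartite graph with n ≥ 4 vertices and m ≥ n edges. Then Sz(G) − W(G) ≥ 4n − 8. -/

import Mathlib

open Finset

variable {V : Type*} [Fintype V] [DecidableEq V]

/-- Number of vertices strictly closer to `u` than to `v`. -/
noncomputable def nCloser (G : SimpleGraph V) (u v : V) : ℕ :=
  (Finset.univ.filter (fun w => G.dist u w < G.dist v w)).card

/-- Number of vertices equidistant from `u` and `v`. -/
noncomputable def nEqual (G : SimpleGraph V) (u v : V) : ℕ :=
  (Finset.univ.filter (fun w => G.dist u w = G.dist v w)).card

/-- `n_0(e)` for an edge `e`. -/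
noncomputable def nZero (G : SimpleGraph V) : Sym2 V → ℕ :=
  Sym2.lift ⟨fun u v => nEqual G u v, by
    intro u v
    unfold nEqual
    exact congrArg Finset.card (Finset.filter_congr fun w _ => eq_comm)⟩

/-- The contribution `n_u(e) * n_v(e)` of an edge `e`. -/
noncomputable def edgeContribution (G : SimpleGraph V) : Sym2 V → ℕ :=
  Sym2.lift ⟨fun u v => nCloser G u v * nCloser G v u, fun u v => Nat.mul_comm _ _⟩

/-- The Szeged index `Sz(G) = ∑_{e = uv ∈ E} n_u(e) n_v(e)`. -/
noncomputable def szeged (G : SimpleGraph V) [DecidableRel G.Adj] : ℕ :=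
  ∑ e ∈ G.edgeFinset, edgeContribution G e

/-- The revised Szeged index `Sz*(G) = ∑_{e=uv∈E} (n_u(e)+n_0(e)/2)(n_v(e)+n_0(e)/2)`. -/
noncomputable def szegedStar (G : SimpleGraph V) [DecidableRel G.Adj] : ℚ :=
  ∑ e ∈ G.edgeFinset,
    Sym2.lift ⟨fun u v =>
      ((nCloser G u v : ℚ) + (nEqual G u v : ℚ) / 2) *
        ((nCloser G v u : ℚ) + (nEqual G u v : ℚ) / 2), by
      intro u v
      have h : nEqual G u v = nEqual G v u := by
        unfold nEqual
        exact congrArg Finset.card (Finset.filter_congr fun w _ => eq_comm)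
      dsimp only; rw [h]; ring⟩ e

/-- The Wiener index `W(G) = ∑_{{x,y} ⊆ V} d(x,y)`. -/
noncomputable def wiener (G : SimpleGraph V) : ℕ :=
  ∑ p ∈ Finset.univ.sym2, Sym2.lift ⟨fun x y => G.dist x y, fun x y => G.dist_comm⟩ p

/-- `μ_{x,y}(e)`: the indicator that `x` and `y` are strictly closer to
opposite endpoints of the edge `e`. -/
noncomputable def mu (G : SimpleGraph V) (x y : V) : Sym2 V → ℕ :=
  Sym2.lift ⟨fun u v =>
    if (G.dist x u < G.dist x v ∧ G.dist y v < G.dist y u) ∨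
        (G.dist x v < G.dist x u ∧ G.dist y u < G.dist y v) then 1 else 0, by
    intro u v
    dsimp only; exact if_congr or_comm rfl rfl⟩

/-- A graph is 2-connected if it has at least 3 vertices and removing any
single vertex leaves it connected. -/
def TwoConnected (G : SimpleGraph V) : Prop :=
  3 ≤ Fintype.card V ∧ ∀ v : V, (G.induce {u : V | u ≠ v}).Connected


/-- `x` and `y` stay connected after deleting any single edge. -/
def TwoEdgeReach (G : SimpleGraph V) (x y : V) : Prop :=
  ∀ e : Sym2 V, (G.deleteEdges {e}).Reachable x y

theorem exists_crossing (H : SimpleGraph V) (h : V → ℕ) (k : ℕ) {a c : V} (p : H.Walk a c)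
    (ha : h a < k) (hc : k ≤ h c) : ∃ x y, H.Adj x y ∧ h x < k ∧ k ≤ h y := by
  induction p with
  | nil => omega
  | @cons u v w huv p ih =>
    by_cases hv : h v < k
    · exact ih hv hc
    · exact ⟨u, v, huv, ha, not_lt.mp hv⟩

theorem cut_count (G : SimpleGraph V) (hconn : G.Connected)
    (h : V → ℕ) (hL : ∀ x y, G.Adj x y → h y ≤ h x + 1) (d : ℕ) (a v c : V)
    (hv : h v = 0) (hc : h c = d) (hR : TwoEdgeReach G a c) (S : Finset (Sym2 V))
    (hS : ∀ x y, G.Adj x y → h x < h y → s(x, y) ∈ S) : d + (d - h a) ≤ S.card := by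
  classical
  let C : ℕ → Finset (Sym2 V) := fun k =>
    S.filter (fun e => ∃ x y, e = s(x, y) ∧ G.Adj x y ∧ h x < k ∧ k ≤ h y)
  have hmem : ∀ k x y, G.Adj x y → h x < k → k ≤ h y → s(x, y) ∈ C k := by
    intro k x y hxy h1 h2
    exact Finset.mem_filter.mpr ⟨hS x y hxy (by omega), x, y, rfl, hxy, h1, h2⟩
  have hdisj : Set.PairwiseDisjoint (↑(Finset.Icc 1 d)) C := by
    intro k _ l _ hkl
    refine Finset.disjoint_left.mpr ?_
    intro e he he'
    obtain ⟨-, x, y, rfl, hxy, h1, h2⟩ := Finset.mem_filter.mp he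
    obtain ⟨-, x', y', hee, hxy', h1', h2'⟩ := Finset.mem_filter.mp he'
    have := hL x y hxy
    rcases Sym2.eq_iff.mp hee with ⟨rfl, rfl⟩ | ⟨rfl, rfl⟩ <;> omega
  have hsub : (Finset.Icc 1 d).biUnion C ⊆ S :=
    Finset.biUnion_subset.mpr fun k _ => Finset.filter_subset _ _
  have hcard := Finset.card_le_card hsub
  rw [Finset.card_biUnion hdisj] at hcard
  refine le_trans ?_ hcard
  have hlow : ∑ k ∈ Finset.Icc 1 d, (1 + if h a < k then 1 else 0) ≤
      ∑ k ∈ Finset.Icc 1 d, (C k).card := by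
    refine Finset.sum_le_sum fun k hk => ?_
    rw [Finset.mem_Icc] at hk
    obtain ⟨p⟩ := hconn.preconnected v c
    obtain ⟨x, y, hxy, h1, h2⟩ := exists_crossing G h k p (by omega) (by omega)
    have m1 := hmem k x y hxy h1 h2
    split_ifs with hak
    · obtain ⟨q⟩ := hR s(x, y)
      obtain ⟨x', y', hxy', h1', h2'⟩ := exists_crossing _ h k q hak (by omega)
      rw [SimpleGraph.deleteEdges_adj] at hxy'
      have m2 := hmem k x' y' hxy'.1 h1' h2'
      have : 1 < (C k).card := Finset.one_lt_card.mpr ⟨_, m1, _, m2, fun hh => hxy'.2 (by simp [hh])⟩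
      omega
    · have : 0 < (C k).card := Finset.card_pos.mpr ⟨_, m1⟩
      omega
  refine le_trans (le_of_eq ?_) hlow
  rw [Finset.sum_add_distrib, Finset.sum_boole]
  have : (Finset.Icc 1 d).filter (fun k => h a < k) = Finset.Icc (h a + 1) d := by
    ext k; simp only [Finset.mem_filter, Finset.mem_Icc]; omega
  rw [this]
  simp

theorem dist_parity (G : SimpleGraph V) (hconn : G.Connected) (c : G.Coloring Bool) (x y : V) :
    Even (G.dist x y) ↔ (c x = c y) := by
  obtain ⟨p, hp⟩ := hconn.exists_walk_length_eq_dist x y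
  rw [← hp, c.even_length_iff_congr p]
  cases c x <;> cases c y <;> simp

theorem dist_tri_even (G : SimpleGraph V) (hconn : G.Connected) (c : G.Coloring Bool) (x y z : V) :
    (G.dist x y + G.dist y z + G.dist x z) % 2 = 0 := by
  have h1 := dist_parity G hconn c x y
  have h2 := dist_parity G hconn c y z
  have h3 := dist_parity G hconn c x z
  rw [Nat.even_iff] at h1 h2 h3
  cases hx : c x <;> cases hy : c y <;> cases hz : c z <;> simp [hx, hy, hz] at h1 h2 h3 <;> omega

/-- Main estimate. -/
theorem key (G : SimpleGraph V) [DecidableRel G.Adj] (hconn : G.Connected) (col : G.Coloring Bool)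
    (v a c : V) (hR : TwoEdgeReach G a c) :
    3 * G.dist v c + G.dist a c ≤ 2 * (∑ e ∈ G.edgeFinset, mu G v c e) + G.dist v a := by
  classical
  let h : V → ℕ := fun w => (G.dist v w + G.dist v c - G.dist c w) / 2
  have h2 : ∀ w, 2 * h w + G.dist c w = G.dist v w + G.dist v c := by
    intro w
    have t1 := hconn.dist_triangle (u := c) (v := v) (w := w)
    have t2 := dist_tri_even G hconn col v c w
    rw [G.dist_comm (u := c) (v := v)] at t1
    simp only [h]
    omega
  have hadj : ∀ x y, G.Adj x y → ∀ w, G.dist w y ≤ G.dist w x + 1 := by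
    intro x y hxy w
    have t1 := hconn.dist_triangle (u := w) (v := x) (w := y)
    rwa [SimpleGraph.dist_eq_one_iff_adj.mpr hxy] at t1
  have hcc : G.dist c c = 0 := SimpleGraph.dist_self
  have hvv : G.dist v v = 0 := SimpleGraph.dist_self
  have hcv : G.dist c v = G.dist v c := G.dist_comm
  have hca : G.dist c a = G.dist a c := G.dist_comm
  have hsum : ∑ e ∈ G.edgeFinset, mu G v c e = (G.edgeFinset.filter (fun e => mu G v c e = 1)).card := by
    rw [Finset.card_filter]
    refine Finset.sum_congr rfl fun e _ => ?_
    induction e with | h x y =>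
    simp only [mu, Sym2.lift_mk]
    split_ifs <;> simp_all
  have hcut := cut_count G hconn h (d := G.dist v c) (a := a) (v := v) (c := c)
    (hL := by
      intro x y hxy
      have := hadj x y hxy v
      have := hadj y x hxy.symm c
      have := h2 x
      have := h2 y
      omega)
    (hv := by have := h2 v; omega) (hc := by have := h2 c; omega) hR
    (G.edgeFinset.filter (fun e => mu G v c e = 1)) (by
      intro x y hxy hlt
      refine Finset.mem_filter.mpr ⟨by simpa using hxy, ?_⟩
      have := hadj x y hxy v
      have := hadj y x hxy.symm c
      have := h2 x
      have := h2 y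
      simp only [mu, Sym2.lift_mk]
      rw [if_pos]
      left
      omega)
  have := h2 a
  rw [hsum]
  omega

theorem mu_ge_dist (G : SimpleGraph V) [DecidableRel G.Adj] (hconn : G.Connected)
    (col : G.Coloring Bool) (v c : V) : G.dist v c ≤ ∑ e ∈ G.edgeFinset, mu G v c e := by
  have := key G hconn col v c c (fun e => SimpleGraph.Reachable.refl _)
  omega

theorem two_wiener (G : SimpleGraph V) :
    2 * wiener G = ∑ x, ∑ y, G.dist x y := by
  classical
  let F : Sym2 V → ℕ := Sym2.lift ⟨fun x y => G.dist x y, fun x y => G.dist_comm⟩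
  have h1 : ∑ x, ∑ y, G.dist x y = ∑ p : V × V, F s(p.1, p.2) := by
    rw [Fintype.sum_prod_type]; rfl
  rw [h1, wiener, Finset.mul_sum]
  rw [← Finset.sum_fiberwise_of_maps_to (s := (Finset.univ : Finset (V × V)))
    (t := (Finset.univ : Finset V).sym2) (g := fun p => s(p.1, p.2)) (by simp)]
  refine Finset.sum_congr rfl fun e _ => ?_
  induction e with | h x y =>
  by_cases hxy : x = y
  · subst hxy
    rw [Finset.sum_eq_zero]
    · simp
    · intro p hp
      rw [(Finset.mem_filter.mp hp).2]
      simp [F]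
  · have : (Finset.univ.filter (fun p : V × V => s(p.1, p.2) = s(x, y))) = {(x, y), (y, x)} := by
      ext ⟨u, w⟩
      simp
    rw [this, Finset.sum_pair (by simp [hxy])]
    simp [F, G.dist_comm (u := y) (v := x), two_mul]

theorem two_szeged (G : SimpleGraph V) [DecidableRel G.Adj] :
    2 * szeged G = ∑ x, ∑ y, ∑ e ∈ G.edgeFinset, mu G x y e := by
  classical
  have h1 : ∑ x, ∑ y, ∑ e ∈ G.edgeFinset, mu G x y e
      = ∑ e ∈ G.edgeFinset, ∑ x, ∑ y, mu G x y e := by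
    rw [Finset.sum_comm]
    simp_rw [Finset.sum_comm (s := (Finset.univ : Finset V)) (t := G.edgeFinset)]
    refine Finset.sum_congr rfl fun e _ => Finset.sum_comm
  rw [h1, szeged, Finset.mul_sum]
  refine Finset.sum_congr rfl fun e _ => ?_
  induction e with | h u v =>
  simp only [edgeContribution, mu, Sym2.lift_mk]
  have h2 : ∀ x y, (if (G.dist x u < G.dist x v ∧ G.dist y v < G.dist y u) ∨
        (G.dist x v < G.dist x u ∧ G.dist y u < G.dist y v) then 1 else 0) =
      (if G.dist u x < G.dist v x then 1 else 0) * (if G.dist v y < G.dist u y then 1 else 0) +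
      (if G.dist v x < G.dist u x then 1 else 0) * (if G.dist u y < G.dist v y then 1 else 0) := by
    intro x y
    rw [G.dist_comm (u := x) (v := u), G.dist_comm (u := x) (v := v),
      G.dist_comm (u := y) (v := u), G.dist_comm (u := y) (v := v)]
    split_ifs <;> omega
  simp_rw [h2, Finset.sum_add_distrib, ← Finset.mul_sum, ← Finset.sum_mul]
  simp only [Finset.sum_boole, nCloser, Nat.cast_id]
  ring

theorem TwoEdgeReach.symm {G : SimpleGraph V} {x y : V} (h : TwoEdgeReach G x y) :
    TwoEdgeReach G y x := fun e => (h e).symm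

theorem TwoEdgeReach.trans {G : SimpleGraph V} {x y z : V} (h : TwoEdgeReach G x y)
    (h' : TwoEdgeReach G y z) : TwoEdgeReach G x z := fun e => (h e).trans (h' e)

theorem two_edge_reach_of_cycle (G : SimpleGraph V) {u : V} (p : G.Walk u u) (hp : p.IsCycle)
    (i : ℕ) (hi : i < p.length) : TwoEdgeReach G (p.getVert i) (p.getVert (i + 1)) := by
  intro e
  have hadj := p.adj_getVert_succ hi
  by_cases he : e = s(p.getVert i, p.getVert (i + 1))
  · subst he
    by_contra hb
    have hb' : G.IsBridge s(p.getVert i, p.getVert (i + 1)) := hb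
    refine hb'.notMem_edges_of_isCycle hp ?_
    rw [← SimpleGraph.Walk.mem_edges_toSubgraph]
    exact p.toSubgraph_adj_getVert hi
  · refine SimpleGraph.Adj.reachable ?_
    rw [SimpleGraph.deleteEdges_adj]
    exact ⟨hadj, fun h => he (by simpa using h.symm)⟩

theorem exists_quad (G : SimpleGraph V) [DecidableRel G.Adj]
    (hconn : G.Connected) (col : G.Coloring Bool) (hm : Fintype.card V ≤ G.edgeFinset.card) :
    ∃ a b c d : V, a ≠ b ∧ a ≠ c ∧ a ≠ d ∧ b ≠ c ∧ b ≠ d ∧ c ≠ d ∧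
      TwoEdgeReach G a c ∧ TwoEdgeReach G b d ∧ 2 ≤ G.dist a c ∧ 2 ≤ G.dist b d := by
  have hcyc : ¬ G.IsAcyclic := by
    intro hac
    have ht : G.IsTree := ⟨hconn, hac⟩
    have := ht.card_edgeFinset
    omega
  simp only [SimpleGraph.IsAcyclic, not_forall, not_not] at hcyc
  obtain ⟨u, p, hp⟩ := hcyc
  have h3 := hp.three_le_length
  have hev : Even p.length := by rw [col.even_length_iff_congr p]
  have h4 : 4 ≤ p.length := by
    rw [Nat.even_iff] at hev; omega
  have inj : ∀ i j, i < 4 → j < 4 → p.getVert i = p.getVert j → i = j := by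
    intro i j hi hj hij
    exact hp.getVert_injOn' (by rw [Set.mem_ofPred_eq]; omega) (by rw [Set.mem_ofPred_eq]; omega) hij
  have r : ∀ i, i < 4 → TwoEdgeReach G (p.getVert i) (p.getVert (i + 1)) :=
    fun i hi => two_edge_reach_of_cycle G p hp i (by omega)
  have hd : ∀ i, i < 2 → 2 ≤ G.dist (p.getVert i) (p.getVert (i + 2)) := by
    intro i hi
    have hne : p.getVert i ≠ p.getVert (i + 2) := fun h => by
      have := inj i (i + 2) (by omega) (by omega) h
      omega
    have hpos := hconn.pos_dist_of_ne hne
    have c1 := col.valid (p.adj_getVert_succ (i := i) (by omega))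
    have c2 := col.valid (p.adj_getVert_succ (i := i + 1) (by omega))
    have hE : Even (G.dist (p.getVert i) (p.getVert (i + 2))) := by
      rw [dist_parity G hconn col]
      revert c1 c2
      cases col (p.getVert i) <;> cases col (p.getVert (i + 1)) <;>
        cases col (p.getVert (i + 2)) <;> simp_all
    rw [Nat.even_iff] at hE
    omega
  refine ⟨p.getVert 0, p.getVert 1, p.getVert 2, p.getVert 3, ?_, ?_, ?_, ?_, ?_, ?_,
    (r 0 (by omega)).trans (r 1 (by omega)), (r 1 (by omega)).trans (r 2 (by omega)),
    hd 0 (by omega), hd 1 (by omega)⟩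
  all_goals
    intro h
    have := inj _ _ (by omega) (by omega) h
    omega

theorem szeged_sub_wiener_bipartite (G : SimpleGraph V) [DecidableRel G.Adj]
    (hconn : G.Connected) (hbip : G.Colorable 2)
    (hn : 4 ≤ Fintype.card V) (hm : Fintype.card V ≤ G.edgeFinset.card) :
    4 * (Fintype.card V : ℤ) - 8 ≤ (szeged G : ℤ) - (wiener G : ℤ) := by
  obtain ⟨col2⟩ := hbip
  let col : G.Coloring Bool := (SimpleGraph.recolorOfEquiv G finTwoEquiv) col2
  obtain ⟨a, b, c, d, hab, hac, had, hbc, hbd, hcd, Rac, Rbd, dac, dbd⟩ := exists_quad G hconn col hm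
  let f : V → V → ℤ := fun x y => ((∑ e ∈ G.edgeFinset, mu G x y e : ℕ) : ℤ) - (G.dist x y : ℤ)
  have f0 : ∀ x y, 0 ≤ f x y := fun x y => by
    have := mu_ge_dist G hconn col x y
    simp only [f]; omega
  have fsymm : ∀ x y, f x y = f y x := fun x y => by
    have : ∀ e, mu G x y e = mu G y x e := by
      intro e
      induction e with | h u v =>
      simp only [mu, Sym2.lift_mk]
      exact if_congr (by tauto) rfl rfl
    simp only [f, this, G.dist_comm (u := x) (v := y)]
  have fpair : ∀ v x y, TwoEdgeReach G x y → (G.dist x y : ℤ) ≤ f v x + f v y := by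
    intro v x y hR
    have k1 := key G hconn col v x y hR
    have k2 := key G hconn col v y x hR.symm
    rw [G.dist_comm (u := y) (v := x)] at k2
    simp only [f]
    omega
  let Q : Finset V := {a, b, c, d}
  have hQ : Q.card = 4 := by
    simp [Q, hab, hac, had, hbc, hbd, hcd]
  have fQ : ∀ v, 4 ≤ ∑ y ∈ Q, f v y := by
    intro v
    have e : ∑ y ∈ Q, f v y = f v a + (f v b + (f v c + f v d)) := by
      simp only [Q]
      rw [Finset.sum_insert (by simp [hab, hac, had]), Finset.sum_insert (by simp [hbc, hbd]),
        Finset.sum_pair hcd]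
    have := fpair v a c Rac
    have := fpair v b d Rbd
    omega
  have htot : 2 * ((szeged G : ℤ) - (wiener G : ℤ)) = ∑ x, ∑ y, f x y := by
    have e1 := two_szeged G
    have e2 := two_wiener G
    simp only [f, Finset.sum_sub_distrib]
    rw [mul_sub]
    exact_mod_cast congrArg₂ (fun s t : ℕ => (s : ℤ) - (t : ℤ)) e1 e2
  have hsplit : ∑ x, ∑ y, f x y = ∑ x, ∑ y ∈ Q, f x y + ∑ y ∈ Qᶜ, ∑ x, f x y := by
    rw [Finset.sum_comm (s := Qᶜ), ← Finset.sum_add_distrib]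
    exact Finset.sum_congr rfl fun x _ => (Finset.sum_add_sum_compl Q _).symm
  have p1 : (Fintype.card V : ℤ) * 4 ≤ ∑ x, ∑ y ∈ Q, f x y := by
    have := Finset.card_nsmul_le_sum (Finset.univ : Finset V) (fun x => ∑ y ∈ Q, f x y) 4
      (fun x _ => fQ x)
    simpa using this
  have p2 : ((Fintype.card V : ℤ) - 4) * 4 ≤ ∑ y ∈ Qᶜ, ∑ x, f x y := by
    have := Finset.card_nsmul_le_sum Qᶜ (fun y => ∑ x, f x y) 4 (fun y _ => by
      refine (fQ y).trans ?_
      simp_rw [fsymm y]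
      exact Finset.sum_le_sum_of_subset_of_nonneg (Finset.subset_univ _) (fun x _ _ => f0 x y))
    rw [Finset.card_compl, hQ, nsmul_eq_mul, Nat.cast_sub hn] at this
    exact_mod_cast this
  omega
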